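/- Let n ≥ 2, let U_Z be an n×(n−1) real matrix with orthonormal columns all orthogonal to 1ₙ (U_Zᵀ·U_Z = I_{n−1}, U_Zᵀ·1ₙ = 0), let U_core and V_core be orthogonal (n−1)×(n−1) real matrices, and let Σ be a diagonal (n−1)×(n−1) real matrix with all diagonal entries of absolute value at most 1. Then the residual matrix H = J + (U_Z·U_core)·Σ·(U_Z·V_core)ᵀ lies in the affine-constrained spectral sphere Sₙ: H·1ₙ = 1ₙ, 1ₙᵀ·H = 1ₙᵀ, and ‖H‖₂ = 1. -/

import Mathlib

open Matrix

/-- The spectral norm (ℓ²→ℓ² operator norm) of a real square matrix. -/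
noncomputable def specNorm {n : ℕ} (M : Matrix (Fin n) (Fin n) ℝ) : ℝ :=
  ‖Matrix.toEuclideanCLM (𝕜 := ℝ) M‖

/-- The uniform matrix `J = (1/n)·1ₙ1ₙᵀ`. -/
noncomputable def uniformMatrix (n : ℕ) : Matrix (Fin n) (Fin n) ℝ :=
  Matrix.of fun _ _ => (1 : ℝ) / n

theorem dotProduct_self_nonneg_real {ι : Type*} [Fintype ι] (x : ι → ℝ) : 0 ≤ x ⬝ᵥ x :=
  Finset.sum_nonneg fun i _ => mul_self_nonneg (x i)

/-- A matrix with orthonormal columns preserves dot products. -/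
theorem dotProduct_mulVec_of_transpose_mul_self {ι κ : Type*} [Fintype ι] [Fintype κ]
    [DecidableEq κ] {P : Matrix ι κ ℝ} (hP : Pᵀ * P = 1) (y z : κ → ℝ) :
    (P *ᵥ y) ⬝ᵥ (P *ᵥ z) = y ⬝ᵥ z := by
  rw [dotProduct_mulVec, ← mulVec_transpose, mulVec_mulVec, hP, one_mulVec]

theorem transpose_mul_self_mul_of_orthonormal {ι κ : Type*} [Fintype ι] [Fintype κ]
    [DecidableEq κ] {U : Matrix ι κ ℝ} {Q : Matrix κ κ ℝ} (hU : Uᵀ * U = 1) (hQ : Qᵀ * Q = 1) :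
    (U * Q)ᵀ * (U * Q) = 1 := by
  rw [transpose_mul, Matrix.mul_assoc, ← Matrix.mul_assoc Uᵀ, hU, Matrix.one_mul, hQ]

theorem uniformMatrix_mulVec {n : ℕ} (x : Fin n → ℝ) :
    uniformMatrix n *ᵥ x = (((1 : Fin n → ℝ) ⬝ᵥ x) / n) • (1 : Fin n → ℝ) := by
  ext i
  simp [uniformMatrix, mulVec, dotProduct, Finset.mul_sum, div_eq_inv_mul]

theorem uniformMatrix_transpose (n : ℕ) : (uniformMatrix n)ᵀ = uniformMatrix n := rfl

theorem uniformMatrix_mulVec_one {n : ℕ} (hn : n ≠ 0) :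
    uniformMatrix n *ᵥ (1 : Fin n → ℝ) = 1 := by
  rw [uniformMatrix_mulVec]
  simp [hn]

/-- Multiplying by a diagonal contraction does not increase the Euclidean length. -/
theorem dotProduct_mulVec_self_le_of_isDiag {κ : Type*} [Fintype κ] [DecidableEq κ]
    {S : Matrix κ κ ℝ} (hS : S.IsDiag) (hS1 : ∀ i, |S i i| ≤ 1) (y : κ → ℝ) :
    (S *ᵥ y) ⬝ᵥ (S *ᵥ y) ≤ y ⬝ᵥ y := by
  rw [← hS.diagonal_diag]
  refine Finset.sum_le_sum fun i _ => ?_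
  rw [mulVec_diagonal, diag_apply]
  have h : S i i ^ 2 ≤ 1 := (sq_le_one_iff_abs_le_one _).2 (hS1 i)
  nlinarith [mul_self_nonneg (y i)]

/-- Bessel's inequality for the constant vector together with orthonormal columns orthogonal
to it. -/
theorem bessel_one_transpose_mulVec {n : ℕ} {κ : Type*} [Fintype κ] [DecidableEq κ] (hn : n ≠ 0)
    {W : Matrix (Fin n) κ ℝ} (hW : Wᵀ * W = 1) (hW1 : Wᵀ *ᵥ (1 : Fin n → ℝ) = 0)
    (x : Fin n → ℝ) :
    ((1 : Fin n → ℝ) ⬝ᵥ x) ^ 2 / n + (Wᵀ *ᵥ x) ⬝ᵥ (Wᵀ *ᵥ x) ≤ x ⬝ᵥ x := by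
  have hn' : (n : ℝ) ≠ 0 := by exact_mod_cast hn
  set a := (1 : Fin n → ℝ) ⬝ᵥ x with ha
  set y := Wᵀ *ᵥ x with hy
  have h1 : x ⬝ᵥ (1 : Fin n → ℝ) = a := dotProduct_comm _ _
  have h2 : x ⬝ᵥ (W *ᵥ y) = y ⬝ᵥ y := by rw [dotProduct_mulVec, ← mulVec_transpose]
  have h3 : (W *ᵥ y) ⬝ᵥ x = y ⬝ᵥ y := by rw [dotProduct_comm, h2]
  have h4 : (1 : Fin n → ℝ) ⬝ᵥ (W *ᵥ y) = 0 := by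
    rw [dotProduct_mulVec, ← mulVec_transpose, hW1, zero_dotProduct]
  have h5 : (W *ᵥ y) ⬝ᵥ (1 : Fin n → ℝ) = 0 := by rw [dotProduct_comm, h4]
  have h6 : (1 : Fin n → ℝ) ⬝ᵥ (1 : Fin n → ℝ) = n := by simp
  have h := dotProduct_self_nonneg_real (x - (a / n) • (1 : Fin n → ℝ) - W *ᵥ y)
  simp only [sub_dotProduct, dotProduct_sub, smul_dotProduct, dotProduct_smul, smul_eq_mul,
    h1, h2, h3, h4, h5, h6, ← ha, dotProduct_mulVec_of_transpose_mul_self hW] at h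
  have e : a / n * (a / n * n) = a ^ 2 / n := by field_simp
  have e' : a / n * a = a ^ 2 / n := by ring
  linarith

theorem dotProduct_uniformMatrix_add_mulVec_self_le {n : ℕ} {κ : Type*} [Fintype κ]
    [DecidableEq κ] (hn : n ≠ 0) {P W : Matrix (Fin n) κ ℝ} {S : Matrix κ κ ℝ}
    (hP : Pᵀ * P = 1) (hP1 : Pᵀ *ᵥ (1 : Fin n → ℝ) = 0)
    (hW : Wᵀ * W = 1) (hW1 : Wᵀ *ᵥ (1 : Fin n → ℝ) = 0)
    (hS : S.IsDiag) (hS1 : ∀ i, |S i i| ≤ 1) (x : Fin n → ℝ) :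
    ((uniformMatrix n + P * S * Wᵀ) *ᵥ x) ⬝ᵥ ((uniformMatrix n + P * S * Wᵀ) *ᵥ x) ≤
      x ⬝ᵥ x := by
  have hn' : (n : ℝ) ≠ 0 := by exact_mod_cast hn
  have hB := bessel_one_transpose_mulVec hn hW hW1 x
  have hC := dotProduct_mulVec_self_le_of_isDiag hS hS1 (Wᵀ *ᵥ x)
  rw [add_mulVec, ← mulVec_mulVec, ← mulVec_mulVec, uniformMatrix_mulVec]
  set a := (1 : Fin n → ℝ) ⬝ᵥ x
  set y := S *ᵥ (Wᵀ *ᵥ x)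
  have h4 : (1 : Fin n → ℝ) ⬝ᵥ (P *ᵥ y) = 0 := by
    rw [dotProduct_mulVec, ← mulVec_transpose, hP1, zero_dotProduct]
  have h5 : (P *ᵥ y) ⬝ᵥ (1 : Fin n → ℝ) = 0 := by rw [dotProduct_comm, h4]
  have h6 : (1 : Fin n → ℝ) ⬝ᵥ (1 : Fin n → ℝ) = n := by simp
  simp only [add_dotProduct, dotProduct_add, smul_dotProduct, dotProduct_smul, smul_eq_mul,
    h4, h5, h6, dotProduct_mulVec_of_transpose_mul_self hP]
  have e : a / n * (a / n * n) = a ^ 2 / n := by field_simp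
  linarith

theorem specNorm_le_one {n : ℕ} {M : Matrix (Fin n) (Fin n) ℝ}
    (h : ∀ x, (M *ᵥ x) ⬝ᵥ (M *ᵥ x) ≤ x ⬝ᵥ x) : specNorm M ≤ 1 := by
  refine ContinuousLinearMap.opNorm_le_bound _ zero_le_one fun x => ?_
  rw [one_mul, EuclideanSpace.norm_eq, EuclideanSpace.norm_eq]
  refine Real.sqrt_le_sqrt ?_
  simpa [dotProduct, ← sq, ofLp_toEuclideanCLM] using h x.ofLp

/-- A matrix with a nonzero fixed vector has spectral norm at least one. -/
theorem one_le_specNorm {n : ℕ} {M : Matrix (Fin n) (Fin n) ℝ} {x : Fin n → ℝ} (hx : x ≠ 0)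
    (h : M *ᵥ x = x) : 1 ≤ specNorm M := by
  have hle := (Matrix.toEuclideanCLM (𝕜 := ℝ) M).le_opNorm (WithLp.toLp 2 x)
  rw [toEuclideanCLM_toLp, h] at hle
  have hpos : 0 < ‖WithLp.toLp 2 x‖ := norm_pos_iff.2 (by simpa using hx)
  exact le_of_mul_le_mul_right (by rwa [one_mul]) hpos

theorem parameterized_residual_mem_affine_spectral_sphere {n : ℕ} (hn : 2 ≤ n)
    (UZ : Matrix (Fin n) (Fin (n - 1)) ℝ)
    (hUZ : UZᵀ * UZ = 1) (hUZperp : UZᵀ.mulVec (fun _ => (1 : ℝ)) = 0)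
    (Ucore Vcore : Matrix (Fin (n - 1)) (Fin (n - 1)) ℝ)
    (hUcore : Ucoreᵀ * Ucore = 1) (hVcore : Vcoreᵀ * Vcore = 1)
    (S : Matrix (Fin (n - 1)) (Fin (n - 1)) ℝ) (hSdiag : S.IsDiag)
    (hSbound : ∀ i, |S i i| ≤ 1) :
    (uniformMatrix n + (UZ * Ucore) * S * (UZ * Vcore)ᵀ).mulVec (fun _ => (1 : ℝ))
        = (fun _ => (1 : ℝ)) ∧
    Matrix.vecMul (fun _ => (1 : ℝ)) (uniformMatrix n + (UZ * Ucore) * S * (UZ * Vcore)ᵀ)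
        = (fun _ => (1 : ℝ)) ∧
    specNorm (uniformMatrix n + (UZ * Ucore) * S * (UZ * Vcore)ᵀ) = 1 := by
  have hn0 : n ≠ 0 := by omega
  have hperp : UZᵀ *ᵥ (1 : Fin n → ℝ) = 0 := hUZperp
  have hP1 : (UZ * Ucore)ᵀ *ᵥ (1 : Fin n → ℝ) = 0 := by
    rw [transpose_mul, ← mulVec_mulVec, hperp, mulVec_zero]
  have hW1 : (UZ * Vcore)ᵀ *ᵥ (1 : Fin n → ℝ) = 0 := by
    rw [transpose_mul, ← mulVec_mulVec, hperp, mulVec_zero]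
  have hP := transpose_mul_self_mul_of_orthonormal hUZ hUcore
  have hW := transpose_mul_self_mul_of_orthonormal hUZ hVcore
  have hright : (uniformMatrix n + (UZ * Ucore) * S * (UZ * Vcore)ᵀ) *ᵥ (1 : Fin n → ℝ) = 1 := by
    rw [add_mulVec, ← mulVec_mulVec, hW1, mulVec_zero, add_zero, uniformMatrix_mulVec_one hn0]
  have hleft : (1 : Fin n → ℝ) ᵥ* (uniformMatrix n + (UZ * Ucore) * S * (UZ * Vcore)ᵀ) = 1 := by
    rw [vecMul_add, ← vecMul_vecMul, ← vecMul_vecMul, ← mulVec_transpose (UZ * Ucore), hP1,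
      zero_vecMul, zero_vecMul, add_zero, ← mulVec_transpose, uniformMatrix_transpose,
      uniformMatrix_mulVec_one hn0]
  have hone : (1 : Fin n → ℝ) ≠ 0 := fun h =>
    one_ne_zero (congrFun h ⟨0, Nat.pos_of_ne_zero hn0⟩)
  exact ⟨hright, hleft, le_antisymm
    (specNorm_le_one
      (dotProduct_uniformMatrix_add_mulVec_self_le hn0 hP hP1 hW hW1 hSdiag hSbound))
    (one_le_specNorm hone hright)⟩
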